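/- For all nonnegative reals a, b and all p > 1, one has |a·log a − b·log b| ≤ (p/(e(p−1)))·|a−b|^{1/p} + |a−b|·log⁺(|a−b|) + 2·√(min(a,b))·√(|a−b|), where log⁺(x) = log x if x ≥ 1 and 0 otherwise (and 0·log 0 is interpreted as 0). -/

import Mathlib

open Real

lemma aux_log (u : ℝ) (hu : 0 ≤ u) : Real.log (1 + u ^ 2) ≤ u := by
  rw [Real.log_le_iff_le_exp (by positivity)]
  have h := Real.sum_le_exp_of_nonneg hu 4
  simp [Finset.sum_range_succ, Nat.factorial] at h
  nlinarith [mul_nonneg hu (sq_nonneg (u - 3 / 2)), mul_nonneg hu hu]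

lemma aux_log2 (b d : ℝ) (hb : 0 < b) (hd : 0 < d) :
    b * (Real.log (b + d) - Real.log b) ≤ Real.sqrt b * Real.sqrt d := by
  have h := aux_log (Real.sqrt d / Real.sqrt b) (by positivity)
  have hx : 0 < Real.sqrt b := Real.sqrt_pos.2 hb
  have h1 : 1 + (Real.sqrt d / Real.sqrt b) ^ 2 = (b + d) / b := by
    rw [div_pow, Real.sq_sqrt hb.le, Real.sq_sqrt hd.le]
    field_simp
  rw [h1, Real.log_div (by positivity) hb.ne'] at h
  calc _ ≤ b * (Real.sqrt d / Real.sqrt b) := mul_le_mul_of_nonneg_left h hb.le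
    _ = (Real.sqrt b * Real.sqrt b) * (Real.sqrt d / Real.sqrt b) := by
        rw [Real.mul_self_sqrt hb.le]
    _ = _ := by field_simp

lemma aux_key (b d : ℝ) (hb : 0 ≤ b) (hd : 0 < d) :
    d * Real.log d ≤ (b + d) * Real.log (b + d) - b * Real.log b ∧
    (b + d) * Real.log (b + d) - b * Real.log b
      ≤ d * Real.log d + 2 * Real.sqrt b * Real.sqrt d := by
  rcases hb.eq_or_lt with rfl | hb
  · simp
  have h1 := aux_log2 b d hb hd
  have h2 := aux_log2 d b hd hb
  rw [add_comm d b] at h2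
  have h3 : Real.log b ≤ Real.log (b + d) := Real.log_le_log hb (by linarith)
  have h4 : Real.log d ≤ Real.log (b + d) := Real.log_le_log hd (by linarith)
  constructor
  · nlinarith [mul_nonneg hb.le (sub_nonneg.2 h3), mul_nonneg hd.le (sub_nonneg.2 h4)]
  · nlinarith

lemma aux_low (d p : ℝ) (hd : 0 < d) (hp : 1 < p) :
    -(d * Real.log d) ≤ (p / (Real.exp 1 * (p - 1))) * d ^ (1 / p) := by
  have hp1 : 0 < p - 1 := by linarith
  have hp0 : 0 < p := by linarith
  obtain ⟨s, hs⟩ : ∃ s, s = (p - 1) / p := ⟨_, rfl⟩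
  have hs0 : 0 < s := by rw [hs]; positivity
  have hc : p / (Real.exp 1 * (p - 1)) = Real.exp (-1) / s := by
    rw [hs, Real.exp_neg]; field_simp
  have h1 : -(s * Real.log d) ≤ Real.exp (-(s * Real.log d) - 1) := by
    linarith [Real.add_one_le_exp (-(s * Real.log d) - 1)]
  have hd1 : d = d ^ (1 / p) * Real.exp (s * Real.log d) := by
    rw [Real.rpow_def_of_pos hd, ← Real.exp_add]
    have : Real.log d * (1 / p) + s * Real.log d = Real.log d := by
      rw [hs]; field_simp; ring
    rw [this, Real.exp_log hd]
  have h2 : Real.exp (s * Real.log d) * -(s * Real.log d) ≤ Real.exp (-1) := by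
    calc _ ≤ Real.exp (s * Real.log d) * Real.exp (-(s * Real.log d) - 1) :=
          mul_le_mul_of_nonneg_left h1 (Real.exp_pos _).le
      _ = _ := by rw [← Real.exp_add]; congr 1; ring
  have hr : 0 < d ^ (1 / p) := Real.rpow_pos_of_pos hd _
  rw [hc, div_mul_eq_mul_div, le_div_iff₀ hs0]
  calc -(d * Real.log d) * s = d * -(s * Real.log d) := by ring
    _ = d ^ (1 / p) * (Real.exp (s * Real.log d) * -(s * Real.log d)) := by
        rw [← mul_assoc, ← hd1]
    _ ≤ d ^ (1 / p) * Real.exp (-1) := mul_le_mul_of_nonneg_left h2 hr.le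
    _ = _ := by ring

lemma aux_main (a b p : ℝ) (hb : 0 ≤ b) (hba : b ≤ a) (hp : 1 < p) :
    |a * Real.log a - b * Real.log b| ≤
      (p / (Real.exp 1 * (p - 1))) * |a - b| ^ (1 / p)
        + |a - b| * max (Real.log |a - b|) 0
        + 2 * Real.sqrt (min a b) * Real.sqrt |a - b| := by
  have hp1 : 0 < p - 1 := by linarith
  have hp0 : 0 < p := by linarith
  rcases hba.eq_or_lt with rfl | hlt
  · rw [sub_self, abs_zero]; positivity
  obtain ⟨d, rfl⟩ : ∃ d, a = b + d := ⟨a - b, by ring⟩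
  have hd : 0 < d := by linarith
  rw [min_eq_right hba, add_sub_cancel_left, abs_of_pos hd]
  obtain ⟨h1, h2⟩ := aux_key b d hb hd
  have h3 := aux_low d p hd hp
  have h4 : 0 ≤ (p / (Real.exp 1 * (p - 1))) * d ^ (1 / p) := by positivity
  have h5 : 0 ≤ 2 * Real.sqrt b * Real.sqrt d := by positivity
  have h6 : 0 ≤ d * max (Real.log d) 0 := by positivity
  have h7 : d * Real.log d ≤ d * max (Real.log d) 0 :=
    mul_le_mul_of_nonneg_left (le_max_left _ _) hd.le
  rw [abs_le]
  constructor <;> linarith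



/-- For all nonnegative reals `a`, `b` and all `p > 1`:
`|a log a − b log b| ≤ (p/(e(p−1)))·|a−b|^{1/p} + |a−b|·log⁺(|a−b|) + 2·√(min a b)·√|a−b|`,
where `log⁺ x = max (log x) 0` (note `Real.log 0 = 0`, so `0·log 0 = 0`). -/
theorem stmt_0 (a b p : ℝ) (ha : 0 ≤ a) (hb : 0 ≤ b) (hp : 1 < p) :
    |a * Real.log a - b * Real.log b| ≤
      (p / (Real.exp 1 * (p - 1))) * |a - b| ^ (1 / p)
        + |a - b| * max (Real.log |a - b|) 0
        + 2 * Real.sqrt (min a b) * Real.sqrt |a - b| := by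

  rcases le_total b a with h | h
  · exact aux_main a b p hb h hp
  · have := aux_main b a p ha h hp
    rwa [abs_sub_comm b a, min_comm b a, abs_sub_comm (b * Real.log b)] at this
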